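/- arXiv:math/0605188 — 4 statements merged into one kernel-verified Lean document; each statement's English description precedes it below -/
import Mathlib

section
/- For every state-feedback policy μ : X → U and all initial states x₀, x₀' ∈ X, the decentralized policy μ_d satisfies J̄(μ_d, x₀) ≤ 2 · J_(μ, x₀'). In particular, the limsup average cost of μ_d is at most twice the liminf average cost of an optimal state-feedback policy from any initial state. -/
open Filter Finset

/-- Distribution of the chain after `t` steps under kernel `K`, started at `x₀`:
the `t`-fold monadic bind of `K` applied to the point mass at `x₀`. -/
noncomputable def chainDist {X : Type*} (K : X → PMF X) (x₀ : X) : ℕ → PMF X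
  | 0 => PMF.pure x₀
  | t + 1 => (chainDist K x₀ t).bind K

/-- Expectation of `f` under a PMF on a finite type. -/
noncomputable def pmfExp {X : Type*} [Fintype X] (q : PMF X) (f : X → ℝ) : ℝ :=
  ∑ x, (q x).toReal * f x

/-- The average cost over periods `0,…,T` of running the Markov chain with step
kernel `K` and per-stage cost `c`, started at `x₀`. -/
noncomputable def avgCost {X : Type*} [Fintype X] (K : X → PMF X) (c : X → ℝ)
    (x₀ : X) (T : ℕ) : ℝ :=
  (1 / (T + 1 : ℝ)) * ∑ t ∈ Finset.range (T + 1), pmfExp (chainDist K x₀ t) c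

/-- Step kernel of the stochastic `k`-server problem under policy `μ`: the state is
`(x̂, x₁, …, x_k)`; server `μ x` relocates to the request location `x.1` and the next
request is drawn from `p`. -/
noncomputable def kServerKernel {S : Type*} {k : ℕ} (p : PMF S)
    (μ : S × (Fin k → S) → Fin k) (x : S × (Fin k → S)) : PMF (S × (Fin k → S)) :=
  p.map (fun s => (s, Function.update x.2 (μ x) x.1))

/-- Per-stage cost of the stochastic `k`-server problem under policy `μ`:
the distance from the dispatched server to the request location. -/
noncomputable def kServerCost {S : Type*} [MetricSpace S] {k : ℕ}
    (μ : S × (Fin k → S) → Fin k) (x : S × (Fin k → S)) : ℝ :=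
  dist (x.2 (μ x)) x.1

/-- The `k`-median objective `g(m) = Σ_s p(s) · min_i d(m_i, s)`. -/
noncomputable def kMedian {S : Type*} [Fintype S] [MetricSpace S] {k : ℕ} [NeZero k]
    (p : PMF S) (m : Fin k → S) : ℝ :=
  ∑ s, (p s).toReal * Finset.univ.inf' Finset.univ_nonempty (fun i => dist (m i) s)

theorem pmfExp_bind {X Y : Type*} [Fintype X] [Fintype Y] (q : PMF X) (K : X → PMF Y)
    (f : Y → ℝ) : pmfExp (q.bind K) f = pmfExp q fun x => pmfExp (K x) f := by
  have bind_toReal (y : Y) :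
      ((q.bind K) y).toReal = ∑ x, (q x).toReal * (K x y).toReal := by
    rw [PMF.bind_apply, tsum_fintype, ENNReal.toReal_sum]
    · simp only [ENNReal.toReal_mul]
    · exact fun x _ => ENNReal.mul_ne_top (q.apply_ne_top x) ((K x).apply_ne_top y)
  simp only [pmfExp, bind_toReal, Finset.sum_mul, Finset.mul_sum]
  rw [Finset.sum_comm]
  simp only [mul_assoc]

theorem pmfExp_pure {X : Type*} [Fintype X] (a : X) (f : X → ℝ) :
    pmfExp (PMF.pure a) f = f a := by
  classical
  simp [pmfExp, PMF.pure_apply, apply_ite ENNReal.toReal]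

theorem pmfExp_map {X Y : Type*} [Fintype X] [Fintype Y] (q : PMF X) (φ : X → Y) (f : Y → ℝ) :
    pmfExp (q.map φ) f = pmfExp q fun x => f (φ x) := by
  rw [← PMF.bind_pure_comp, pmfExp_bind]
  simp only [Function.comp_apply, pmfExp_pure]

theorem pmfExp_add {X : Type*} [Fintype X] (q : PMF X) (f g : X → ℝ) :
    pmfExp q (fun x => f x + g x) = pmfExp q f + pmfExp q g := by
  simp only [pmfExp, mul_add, Finset.sum_add_distrib]

theorem pmfExp_neg {X : Type*} [Fintype X] (q : PMF X) (f : X → ℝ) :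
    pmfExp q (fun x => -f x) = -pmfExp q f := by
  simp only [pmfExp, mul_neg, Finset.sum_neg_distrib]

theorem pmfExp_const_mul {X : Type*} [Fintype X] (q : PMF X) (a : ℝ) (f : X → ℝ) :
    pmfExp q (fun x => a * f x) = a * pmfExp q f := by
  simp only [pmfExp, Finset.mul_sum, mul_left_comm]

theorem pmfExp_const {X : Type*} [Fintype X] (q : PMF X) (a : ℝ) :
    pmfExp q (fun _ => a) = a := by
  have toReal_sum : ∑ x, (q x).toReal = 1 := by
    rw [← ENNReal.toReal_sum fun x _ => q.apply_ne_top x,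
      ← tsum_fintype (L := .unconditional X), q.tsum_coe, ENNReal.toReal_one]
  rw [pmfExp, ← Finset.sum_mul, toReal_sum, one_mul]

theorem pmfExp_mono {X : Type*} [Fintype X] (q : PMF X) {f g : X → ℝ} (h : ∀ x, f x ≤ g x) :
    pmfExp q f ≤ pmfExp q g :=
  Finset.sum_le_sum fun x _ => mul_le_mul_of_nonneg_left (h x) ENNReal.toReal_nonneg

theorem abs_pmfExp_le {X : Type*} [Fintype X] (q : PMF X) (f : X → ℝ) :
    |pmfExp q f| ≤ ∑ x, |f x| := by
  have abs_le_sum (x : X) : |f x| ≤ ∑ y, |f y| :=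
    Finset.single_le_sum (fun y _ => abs_nonneg (f y)) (Finset.mem_univ x)
  rw [abs_le]
  constructor
  · rw [← pmfExp_const q (-∑ x, |f x|)]
    exact pmfExp_mono q fun x => (abs_le.mp (abs_le_sum x)).1
  · rw [← pmfExp_const q (∑ x, |f x|)]
    exact pmfExp_mono q fun x => (abs_le.mp (abs_le_sum x)).2

theorem abs_avgCost_le {X : Type*} [Fintype X] (K : X → PMF X) (c : X → ℝ) (x₀ : X) (T : ℕ) :
    |avgCost K c x₀ T| ≤ ∑ x, |c x| := by
  have hT : (0 : ℝ) < T + 1 := by positivity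
  rw [avgCost, abs_mul, abs_of_pos (by positivity), one_div, inv_mul_le_iff₀ hT]
  calc _ ≤ ∑ t ∈ Finset.range (T + 1), |pmfExp (chainDist K x₀ t) c| :=
        Finset.abs_sum_le_sum_abs _ _
    _ ≤ ∑ _t ∈ Finset.range (T + 1), ∑ x, |c x| :=
        Finset.sum_le_sum fun t _ => abs_pmfExp_le _ c
    _ = _ := by simp

theorem avgCost_neg {X : Type*} [Fintype X] (K : X → PMF X) (c : X → ℝ) (x₀ : X) (T : ℕ) :
    avgCost K (fun x => -c x) x₀ T = -avgCost K c x₀ T := by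
  simp only [avgCost, pmfExp_neg, Finset.sum_neg_distrib, mul_neg]

/-- Telescoping of a Lyapunov drift inequality with potential `Ψ`. -/
theorem sum_cost_add_potential_le {X : Type*} [Fintype X] {K : X → PMF X} {c Ψ : X → ℝ} {a : ℝ}
    (h : ∀ x, c x + pmfExp (K x) Ψ ≤ Ψ x + a) (x₀ : X) (n : ℕ) :
    ∑ t ∈ Finset.range n, pmfExp (chainDist K x₀ t) c + pmfExp (chainDist K x₀ n) Ψ ≤
      Ψ x₀ + n * a := by
  induction n with
  | zero => simp [chainDist, pmfExp_pure]
  | succ n ih =>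
    have step := pmfExp_mono (chainDist K x₀ n) h
    rw [pmfExp_add, pmfExp_add, pmfExp_const, ← pmfExp_bind] at step
    rw [Finset.sum_range_succ, chainDist]
    push_cast
    linarith

theorem avgCost_le_of_drift {X : Type*} [Fintype X] {K : X → PMF X} {c Ψ : X → ℝ} {a : ℝ}
    (h : ∀ x, c x + pmfExp (K x) Ψ ≤ Ψ x + a) (x₀ : X) (T : ℕ) :
    avgCost K c x₀ T ≤ a + (Ψ x₀ + ∑ x, |Ψ x|) * (1 / (T + 1 : ℝ)) := by
  have hT : (0 : ℝ) < T + 1 := by positivity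
  have total := sum_cost_add_potential_le h x₀ (T + 1)
  have final := (abs_le.mp (abs_pmfExp_le (chainDist K x₀ (T + 1)) Ψ)).1
  push_cast at total
  calc avgCost K c x₀ T
      ≤ (1 / (T + 1 : ℝ)) * ((T + 1) * a + (Ψ x₀ + ∑ x, |Ψ x|)) :=
        mul_le_mul_of_nonneg_left (by linarith) (by positivity)
    _ = _ := by field_simp

theorem tendsto_add_mul_one_div (a b : ℝ) :
    Tendsto (fun T : ℕ => a + b * (1 / (T + 1 : ℝ))) atTop (nhds a) := by
  simpa using (tendsto_one_div_add_atTop_nhds_zero_nat (𝕜 := ℝ)).const_mul b |>.const_add a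

theorem limsup_avgCost_le_of_drift {X : Type*} [Fintype X] {K : X → PMF X} {c Ψ : X → ℝ} {a : ℝ}
    (h : ∀ x, c x + pmfExp (K x) Ψ ≤ Ψ x + a) (x₀ : X) :
    limsup (avgCost K c x₀) atTop ≤ a := by
  have lim := tendsto_add_mul_one_div a (Ψ x₀ + ∑ x, |Ψ x|)
  rw [← lim.limsup_eq]
  refine limsup_le_limsup (.of_forall (avgCost_le_of_drift h x₀)) ?_ lim.isBoundedUnder_le
  exact (isBoundedUnder_of (r := (· ≥ ·))
    ⟨_, fun T => (abs_le.mp (abs_avgCost_le K c x₀ T)).1⟩).isCoboundedUnder_flip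

theorem le_liminf_avgCost_of_drift {X : Type*} [Fintype X] {K : X → PMF X} {c Ψ : X → ℝ} {a : ℝ}
    (h : ∀ x, Ψ x + a ≤ c x + pmfExp (K x) Ψ) (x₀ : X) :
    a ≤ liminf (avgCost K c x₀) atTop := by
  have neg_drift (x : X) :
      -c x + pmfExp (K x) (fun y => -Ψ y) ≤ -Ψ x + -a := by
    rw [pmfExp_neg]
    linarith [h x]
  have lim := (tendsto_add_mul_one_div (-a) (-Ψ x₀ + ∑ x, |-Ψ x|)).neg
  rw [neg_neg] at lim
  rw [← lim.liminf_eq]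
  refine liminf_le_liminf (.of_forall fun T => ?_) lim.isBoundedUnder_ge ?_
  · have bound := avgCost_le_of_drift neg_drift x₀ T
    rw [avgCost_neg] at bound
    exact neg_le.mp bound
  · exact (isBoundedUnder_of (r := (· ≤ ·))
      ⟨_, fun T => (abs_le.mp (abs_avgCost_le K c x₀ T)).2⟩).isCoboundedUnder_flip

theorem pmfExp_kServerKernel {S : Type*} [Fintype S] {k : ℕ} (p : PMF S)
    (μ : S × (Fin k → S) → Fin k) (x : S × (Fin k → S)) (f : S × (Fin k → S) → ℝ) :
    pmfExp (kServerKernel p μ x) f =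
      pmfExp p fun s => f (s, Function.update x.2 (μ x) x.1) :=
  pmfExp_map p _ f

/-- Every policy pays at least the optimal `k`-median value on average. -/
theorem kMedian_le_liminf_avgCost {S : Type*} [Fintype S] [MetricSpace S] {k : ℕ} [NeZero k]
    (p : PMF S) (mstar : Fin k → S) (hmstar : ∀ m : Fin k → S, kMedian p mstar ≤ kMedian p m)
    (μ : S × (Fin k → S) → Fin k) (x₀ : S × (Fin k → S)) :
    kMedian p mstar ≤ liminf (avgCost (kServerKernel p μ) (kServerCost μ) x₀) atTop := by
  refine le_liminf_avgCost_of_drift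
    (Ψ := fun x => Finset.univ.inf' Finset.univ_nonempty fun i => dist (x.2 i) x.1)
    (fun x => ?_) x₀
  have nearest : (Finset.univ.inf' Finset.univ_nonempty fun i => dist (x.2 i) x.1) ≤
      kServerCost μ x :=
    Finset.inf'_le (fun i => dist (x.2 i) x.1) (Finset.mem_univ (μ x))
  rw [pmfExp_kServerKernel]
  exact add_le_add nearest (hmstar (Function.update x.2 (μ x) x.1))

theorem sum_dist_update {S ι : Type*} [MetricSpace S] [Fintype ι] [DecidableEq ι]
    (y m : ι → S) (u : ι) (s : S) :
    ∑ i, dist (Function.update y u s i) (m i) =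
      ∑ i, dist (y i) (m i) - dist (y u) (m u) + dist s (m u) := by
  rw [← Finset.add_sum_erase _ _ (Finset.mem_univ u),
    ← Finset.add_sum_erase _ (fun i => dist (y i) (m i)) (Finset.mem_univ u),
    Finset.sum_congr rfl fun i hi => by rw [Function.update_of_ne (Finset.ne_of_mem_erase hi)],
    Function.update_self]
  ring

/-- Dispatching the server attached to the nearest point of `m` costs on average at most twice
the `k`-median value of `m`. -/
theorem limsup_avgCost_le_two_mul_kMedian {S : Type*} [Fintype S] [MetricSpace S] {k : ℕ}
    [NeZero k] (p : PMF S) (m : Fin k → S) (μ : S × (Fin k → S) → Fin k)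
    (hμ : ∀ x : S × (Fin k → S), ∀ j : Fin k, dist (m (μ x)) x.1 ≤ dist (m j) x.1)
    (x₀ : S × (Fin k → S)) :
    limsup (avgCost (kServerKernel p μ) (kServerCost μ) x₀) atTop ≤ 2 * kMedian p m := by
  refine limsup_avgCost_le_of_drift
    (Ψ := fun x => ∑ i, dist (x.2 i) (m i) +
      2 * Finset.univ.inf' Finset.univ_nonempty fun i => dist (m i) x.1) (fun x => ?_) x₀
  have nearest : dist (m (μ x)) x.1 ≤
      Finset.univ.inf' Finset.univ_nonempty fun i => dist (m i) x.1 :=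
    Finset.le_inf' _ _ fun j _ => hμ x j
  have median : pmfExp p (fun s => Finset.univ.inf' Finset.univ_nonempty fun i => dist (m i) s) =
      kMedian p m := rfl
  rw [pmfExp_kServerKernel, pmfExp_add]
  dsimp only
  rw [pmfExp_const, pmfExp_const_mul, median, sum_dist_update, kServerCost, dist_comm x.1 (m (μ x))]
  linarith [dist_triangle (x.2 (μ x)) (m (μ x)) x.1]

/-- The decentralized policy `μ_d`, which dispatches a server whose associated
optimal median is nearest to the request, has limsup average cost at most twice
the liminf average cost of any state-feedback policy. -/
theorem decentralized_policy_within_factor_two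
    {S : Type*} [Fintype S] [Nonempty S] [MetricSpace S] {k : ℕ} [NeZero k]
    (p : PMF S) (mstar : Fin k → S)
    (hmstar : ∀ m : Fin k → S, kMedian p mstar ≤ kMedian p m)
    (μd : S × (Fin k → S) → Fin k)
    (hμd : ∀ x : S × (Fin k → S), ∀ j : Fin k,
      dist (mstar (μd x)) x.1 ≤ dist (mstar j) x.1)
    (hdec : ∀ x y : S × (Fin k → S), x.1 = y.1 → μd x = μd y)
    (μ : S × (Fin k → S) → Fin k) (x₀ x₀' : S × (Fin k → S)) :
    limsup (avgCost (kServerKernel p μd) (kServerCost μd) x₀) atTop ≤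
      2 * liminf (avgCost (kServerKernel p μ) (kServerCost μ) x₀') atTop := by
  linarith [limsup_avgCost_le_two_mul_kMedian p mstar μd hμd x₀,
    kMedian_le_liminf_avgCost p mstar hmstar μ x₀']
end

section
/- For every request location x̂ ∈ S and all server positions x₁,…,x_k ∈ S, let u ∈ Fin k satisfy d(m*_u, x̂) ≤ d(m*_j, x̂) for all j ∈ Fin k, and let x'_i = x̂ if i = u and x'_i = x_i otherwise. Then, with h_U(ŷ, y₁,…,y_k) = 2 · min_{i ∈ Fin k} d(m*_i, ŷ) + Σ_{i=1}^{k} d(y_i, m*_i), the following inequality holds: d(x_u, x̂) + Σ_{s∈S} p(s) · h_U(s, x'₁,…,x'_k) − h_U(x̂, x₁,…,x_k) ≤ 2 · g(m*). -/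
open Finset

/-- The function `h_U(ŷ, y) = 2·min_i d(m*_i, ŷ) + Σ_i d(y_i, m*_i)`. -/
noncomputable def hU {S : Type*} [MetricSpace S] {k : ℕ} [NeZero k]
    (mstar : Fin k → S) (yh : S) (y : Fin k → S) : ℝ :=
  2 * Finset.univ.inf' Finset.univ_nonempty (fun i => dist (mstar i) yh) +
    ∑ i, dist (y i) (mstar i)

/-- Pointwise upper bound on the cost-plus-drift of the decentralized policy with
respect to `h_U`: if `u` is an index whose median `m*_u` is nearest to the request
`x̂`, and `x' = update x u x̂` are the post-decision server positions, then
`d(x_u, x̂) + Σ_s p(s)·h_U(s, x') − h_U(x̂, x) ≤ 2·g(m*)`. -/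
theorem cost_plus_drift_le_two_kMedian
    {S : Type*} [Fintype S] [Nonempty S] [MetricSpace S] {k : ℕ} [NeZero k]
    (p : PMF S) (mstar : Fin k → S)
    (hmstar : ∀ m : Fin k → S, kMedian p mstar ≤ kMedian p m)
    (xh : S) (x : Fin k → S) (u : Fin k)
    (hu : ∀ j : Fin k, dist (mstar u) xh ≤ dist (mstar j) xh) :
    dist (x u) xh +
      (∑ s, (p s).toReal * hU mstar s (Function.update x u xh)) -
      hU mstar xh x ≤
    2 * kMedian p mstar := by
  have sum_update : ∑ i, dist (Function.update x u xh i) (mstar i) =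
      dist xh (mstar u) - dist (x u) (mstar u) + ∑ i, dist (x i) (mstar i) := by
    rw [← add_sum_erase univ (fun i => dist (Function.update x u xh i) (mstar i)) (mem_univ u),
      ← add_sum_erase univ (fun i => dist (x i) (mstar i)) (mem_univ u),
      sum_congr rfl fun i hi => by rw [Function.update_of_ne (ne_of_mem_erase hi)]]
    simp only [Function.update_self]
    ring
  have nearest : univ.inf' univ_nonempty (fun i => dist (mstar i) xh) = dist (mstar u) xh :=
    le_antisymm (inf'_le _ (mem_univ u)) (le_inf' _ _ fun j _ => hu j)
  have drift : ∑ s, (p s).toReal * hU mstar s (Function.update x u xh) =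
      2 * kMedian p mstar + ∑ i, dist (Function.update x u xh i) (mstar i) := by
    have sum_p : ∑ s, (p s).toReal = 1 := by
      rw [← ENNReal.toReal_sum fun s _ => p.apply_ne_top s, ← tsum_fintype (L := .unconditional S),
        p.tsum_coe, ENNReal.toReal_one]
    simp only [hU, kMedian, mul_add, sum_add_distrib, ← sum_mul, sum_p, one_mul,
      mul_left_comm _ (2 : ℝ), ← mul_sum]
  rw [drift, sum_update, hU, nearest]
  linarith [dist_triangle (x u) (mstar u) xh, dist_comm xh (mstar u)]
end

section
/- For every request location x̂ ∈ S and all server positions x₁,…,x_k ∈ S, let u ∈ Fin k satisfy d_u(m*_u, x̂) + c_u(x̂) ≤ d_j(m*_j, x̂) + c_j(x̂) for all j ∈ Fin k, and let x'_i = x̂ if i = u and x'_i = x_i otherwise. Then, with h_U(ŷ, y₁,…,y_k) = 2 · min_{i ∈ Fin k} ( d_i(m*_i, ŷ) + c_i(ŷ) ) + Σ_{i=1}^{k} d_i(y_i, m*_i), the following inequality holds: d_u(x_u, x̂) + c_u(x̂) + Σ_{s∈S} p(s) · h_U(s, x'₁,…,x'_k) − h_U(x̂, x₁,…,x_k) ≤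 2 · g'(m*). -/
open Finset

/-- The generalized `k`-median objective
`g'(m) = Σ_s p(s) · min_i (d_i(m_i, s) + c_i(s))`. -/
noncomputable def sdMedian {S : Type*} [Fintype S] {k : ℕ} [NeZero k]
    (p : PMF S) (d : Fin k → S → S → ℝ) (c : Fin k → S → ℝ) (m : Fin k → S) : ℝ :=
  ∑ s, (p s).toReal *
    Finset.univ.inf' Finset.univ_nonempty (fun i => d i (m i) s + c i s)

/-- The function `h_U(ŷ, y) = 2·min_i (d_i(m*_i, ŷ) + c_i(ŷ)) + Σ_i d_i(y_i, m*_i)`. -/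
noncomputable def sdHU {S : Type*} {k : ℕ} [NeZero k]
    (d : Fin k → S → S → ℝ) (c : Fin k → S → ℝ) (mstar : Fin k → S)
    (yh : S) (y : Fin k → S) : ℝ :=
  2 * Finset.univ.inf' Finset.univ_nonempty (fun i => d i (mstar i) yh + c i yh) +
    ∑ i, d i (y i) (mstar i)

/-- Pointwise upper bound on the cost-plus-drift of the decentralized policy with
respect to `h_U` in the server-dependent cost problem. -/
theorem sd_cost_plus_drift_le_two_sdMedian
    {S : Type*} [Fintype S] [Nonempty S] {k : ℕ} [NeZero k]
    (p : PMF S) (d : Fin k → S → S → ℝ) (c : Fin k → S → ℝ)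
    (hd_nonneg : ∀ i a b, 0 ≤ d i a b)
    (hd_self : ∀ i a, d i a a = 0)
    (hd_symm : ∀ i a b, d i a b = d i b a)
    (hd_tri : ∀ i a b e, d i a e ≤ d i a b + d i b e)
    (hc : ∀ i s, 0 ≤ c i s)
    (mstar : Fin k → S)
    (hmstar : ∀ m : Fin k → S, sdMedian p d c mstar ≤ sdMedian p d c m)
    (xh : S) (x : Fin k → S) (u : Fin k)
    (hu : ∀ j : Fin k, d u (mstar u) xh + c u xh ≤ d j (mstar j) xh + c j xh) :
    d u (x u) xh + c u xh +
      (∑ s, (p s).toReal * sdHU d c mstar s (Function.update x u xh)) -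
      sdHU d c mstar xh x ≤
    2 * sdMedian p d c mstar := by
  have hmin : univ.inf' univ_nonempty (fun i => d i (mstar i) xh + c i xh) =
      d u (mstar u) xh + c u xh :=
    le_antisymm (inf'_le _ (mem_univ u)) (le_inf' _ _ fun j _ => hu j)
  have hsum : ∑ i, d i (Function.update x u xh i) (mstar i) - ∑ i, d i (x i) (mstar i) =
      d u xh (mstar u) - d u (x u) (mstar u) := by
    rw [← sum_sub_distrib, sum_eq_single u]
    · simp
    · intro i _ hi
      simp [Function.update_of_ne hi]
    · simp
  have hE : ∑ s, (p s).toReal * sdHU d c mstar s (Function.update x u xh) =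
      2 * sdMedian p d c mstar + ∑ i, d i (Function.update x u xh i) (mstar i) := by
    have hp : ∑ s, (p s).toReal = 1 := by
      rw [← ENNReal.toReal_sum fun s _ => p.apply_ne_top s, ← tsum_fintype (L := .unconditional S),
        p.tsum_coe, ENNReal.toReal_one]
    simp only [sdHU, sdMedian, mul_add, sum_add_distrib, mul_left_comm _ (2 : ℝ), ← mul_sum]
    rw [← sum_mul, hp, one_mul]
  rw [hE, sdHU, hmin]
  linarith [hd_tri u (x u) (mstar u) xh, hd_symm u xh (mstar u), hc u xh]
end

section
/- For all request locations x̂₁,…,x̂_n ∈ S and all server positions x₁,…,x_k ∈ S, let u ∈ U minimize Σ_{j=1}^{n} d(m*_{u_j}, x̂_j) over U, and let x'_i = x̂_j if i = u_j for some j and x'_i = x_i otherwise. Then, with h_U(ŷ, y) = 2 · min_{v ∈ U} Σ_{j=1}^{n} d(m*_{v_j}, ŷ_j) + Σ_{i=1}^{k} d(y_i, m*_i), the following inequality holds: Σ_{j=1}^{n} d(x_{u_j}, x̂_j) + Σ_{s∈S^n} p(s) · h_U(s, x'₁,…,x'_k) − h_U(x̂, x₁,…,x_k) ≤ 2 ·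 G(m*). -/
open Finset

/-- Injective assignments of the `n` requests to `n` distinct servers among `k`. -/
def Assign (n k : ℕ) : Type := {u : Fin n → Fin k // Function.Injective u}

instance (n k : ℕ) : Fintype (Assign n k) := Subtype.fintype _

/-- The post-decision server positions: server `u_j` relocates to request `x̂_j`
for each `j`, other servers are unchanged. -/
noncomputable def moveServers {S : Type*} {n k : ℕ} (xh : Fin n → S) (xs : Fin k → S)
    (u : Assign n k) : Fin k → S :=
  fun i => if h : ∃ j, u.1 j = i then xh h.choose else xs i

/-- The generalized `k`-median objective for `n` requests per period:
`G(m) = Σ_{s ∈ Sⁿ} p(s) · min_{u} Σ_j d(m_{u_j}, s_j)`. -/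
noncomputable def multiMedian {S : Type*} [Fintype S] [MetricSpace S] {n k : ℕ}
    (hnk : n ≤ k) (p : PMF (Fin n → S)) (m : Fin k → S) : ℝ :=
  ∑ s, (p s).toReal *
    Finset.univ.inf'
      (Finset.univ_nonempty_iff.mpr ⟨⟨Fin.castLE hnk, Fin.castLE_injective hnk⟩⟩)
      (fun u : Assign n k => ∑ j, dist (m (u.1 j)) (s j))

/-- The function `h_U(ŷ, y) = 2·min_v Σ_j d(m*_{v_j}, ŷ_j) + Σ_i d(y_i, m*_i)`. -/
noncomputable def multiHU {S : Type*} [MetricSpace S] {n k : ℕ} (hnk : n ≤ k)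
    (mstar : Fin k → S) (yh : Fin n → S) (y : Fin k → S) : ℝ :=
  2 * Finset.univ.inf'
        (Finset.univ_nonempty_iff.mpr ⟨⟨Fin.castLE hnk, Fin.castLE_injective hnk⟩⟩)
        (fun v : Assign n k => ∑ j, dist (mstar (v.1 j)) (yh j)) +
    ∑ i, dist (y i) (mstar i)

theorem moveServers_apply {S : Type*} {n k : ℕ} (xh : Fin n → S) (xs : Fin k → S)
    (u : Assign n k) (j : Fin n) : moveServers xh xs u (u.1 j) = xh j := by
  have h : ∃ j', u.1 j' = u.1 j := ⟨j, rfl⟩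
  rw [moveServers, dif_pos h, u.2 h.choose_spec]

theorem moveServers_of_notMem_range {S : Type*} {n k : ℕ} (xh : Fin n → S) (xs : Fin k → S)
    (u : Assign n k) {i : Fin k} (hi : i ∉ Set.range u.1) : moveServers xh xs u i = xs i :=
  dif_neg hi

/-- Only the matched servers contribute to the change of the total distance to `m`. -/
theorem sum_dist_moveServers_sub {S : Type*} [MetricSpace S] {n k : ℕ} (xh : Fin n → S)
    (xs m : Fin k → S) (u : Assign n k) :
    ∑ i, dist (moveServers xh xs u i) (m i) - ∑ i, dist (xs i) (m i) =
      ∑ j, (dist (xh j) (m (u.1 j)) - dist (xs (u.1 j)) (m (u.1 j))) := by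
  rw [← Finset.sum_sub_distrib]
  refine (Fintype.sum_of_injective u.1 u.2 _ _ (fun i hi => ?_) fun j => ?_).symm
  · rw [moveServers_of_notMem_range xh xs u hi, sub_self]
  · rw [moveServers_apply]

theorem PMF.sum_toReal {α : Type*} [Fintype α] (p : PMF α) : ∑ a, (p a).toReal = 1 := by
  rw [← ENNReal.toReal_sum fun a _ => p.apply_ne_top a, ← tsum_fintype (L := .unconditional _),
    p.tsum_coe, ENNReal.toReal_one]

theorem sum_toReal_mul_multiHU {S : Type*} [Fintype S] [MetricSpace S] {n k : ℕ} (hnk : n ≤ k)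
    (p : PMF (Fin n → S)) (m y : Fin k → S) :
    ∑ s, (p s).toReal * multiHU hnk m s y =
      2 * multiMedian hnk p m + ∑ i, dist (y i) (m i) := by
  simp only [multiHU, multiMedian, mul_add, Finset.sum_add_distrib]
  rw [← Finset.sum_mul, p.sum_toReal, one_mul, Finset.mul_sum]
  simp only [mul_left_comm]

/-- Pointwise upper bound on the cost-plus-drift of the decentralized policy with
respect to `h_U` in the `n`-requests-per-period problem: if `u` is a minimum-cost
injective matching of the requests `x̂` to the optimal medians `m*`, and `x'` are the
post-decision server positions, then
`Σ_j d(x_{u_j}, x̂_j) + Σ_s p(s)·h_U(s, x') − h_U(x̂, x) ≤ 2·G(m*)`. -/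
theorem multi_cost_plus_drift_le_two_multiMedian
    {S : Type*} [Fintype S] [Nonempty S] [MetricSpace S] {n k : ℕ}
    (hn : 0 < n) (hnk : n ≤ k) (p : PMF (Fin n → S))
    (mstar : Fin k → S)
    (hmstar : ∀ m : Fin k → S, multiMedian hnk p mstar ≤ multiMedian hnk p m)
    (xh : Fin n → S) (x : Fin k → S) (u : Assign n k)
    (hu : ∀ v : Assign n k,
      ∑ j, dist (mstar (u.1 j)) (xh j) ≤ ∑ j, dist (mstar (v.1 j)) (xh j)) :
    (∑ j, dist (x (u.1 j)) (xh j)) +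
      (∑ s, (p s).toReal * multiHU hnk mstar s (moveServers xh x u)) -
      multiHU hnk mstar xh x ≤
    2 * multiMedian hnk p mstar := by
  have hmin : 2 * ∑ j, dist (mstar (u.1 j)) (xh j) + ∑ i, dist (x i) (mstar i) ≤
      multiHU hnk mstar xh x := by
    unfold multiHU
    gcongr
    exact Finset.le_inf' _ _ fun v _ => hu v
  have htri : ∑ j, dist (x (u.1 j)) (xh j) +
      ∑ j, (dist (xh j) (mstar (u.1 j)) - dist (x (u.1 j)) (mstar (u.1 j))) ≤
      2 * ∑ j, dist (mstar (u.1 j)) (xh j) := by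
    rw [← Finset.sum_add_distrib, Finset.mul_sum]
    refine Finset.sum_le_sum fun j _ => ?_
    linarith [dist_triangle (x (u.1 j)) (mstar (u.1 j)) (xh j),
      dist_comm (xh j) (mstar (u.1 j))]
  rw [sum_toReal_mul_multiHU]
  linarith [sum_dist_moveServers_sub xh x mstar u]
end
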